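/- For all integers m, k ≥ 1 with k ≥ m there exist finitely many matrices S_j, T_j in the unital subalgebra of End(V^{⊗(m+k)}) generated by R₁, …, R_{m+k−1} such that every entry of the matrix D_{⟨1→m⟩} · M_{⟨m+1⟩} M_{⟨m+2⟩} ⋯ M_{⟨m+k⟩} − Σ_j S_j · M_{⟨1→(k−m)⟩} · T_j belongs to the left ideal of A generated by the entries of D (with the convention M_{⟨1→0⟩} = I when k = m). If k < m, then every entry of D_{⟨1→m⟩} · M_{⟨m+1⟩} ⋯ M_{⟨m+k⟩} belongs to that left ideal. -/

import Mathlib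

open scoped BigOperators

noncomputable section

/-- One-site embedding of an `N×N` matrix into `Mat_{N^k}` at 0-based position `i`
(the paper's `X_{i+1}` in 1-based numbering).  Out of range we return the identity. -/
def matAt {α : Type*} [Semiring α] (N k : ℕ) (X : Matrix (Fin N) (Fin N) α) (i : ℕ) :
    Matrix (Fin k → Fin N) (Fin k → Fin N) α :=
  if h : i < k then
    Matrix.of fun a b =>
      if ∀ l : Fin k, (l : ℕ) ≠ i → a l = b l then X (a ⟨i, h⟩) (b ⟨i, h⟩) else 0
  else 1

/-- Two-site embedding of an operator on `V⊗V` into `Mat_{N^k}` at 0-based positions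
`i, i+1` (the paper's `R_{i+1}` in 1-based numbering). -/
def opAt {α : Type*} [Semiring α] (N k : ℕ)
    (R : Matrix (Fin N × Fin N) (Fin N × Fin N) α) (i : ℕ) :
    Matrix (Fin k → Fin N) (Fin k → Fin N) α :=
  if h : i + 1 < k then
    Matrix.of fun a b =>
      if ∀ l : Fin k, (l : ℕ) ≠ i → (l : ℕ) ≠ i + 1 → a l = b l then
        R (a ⟨i, by omega⟩, a ⟨i + 1, h⟩) (b ⟨i, by omega⟩, b ⟨i + 1, h⟩)
      else 0
  else 1

/-- A numeric (complex) matrix viewed inside `Mat(A)` via the unit of `A`. -/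
def toA (A : Type*) [Semiring A] [Algebra ℂ A] {ι : Type*} (X : Matrix ι ι ℂ) :
    Matrix ι ι A :=
  X.map (algebraMap ℂ A)

/-- The braid relation `R₁R₂R₁ = R₂R₁R₂` on `V^{⊗3}`. -/
def IsBraid (N : ℕ) (R : Matrix (Fin N × Fin N) (Fin N × Fin N) ℂ) : Prop :=
  opAt N 3 R 0 * opAt N 3 R 1 * opAt N 3 R 0 = opAt N 3 R 1 * opAt N 3 R 0 * opAt N 3 R 1

/-- The Hecke condition `(q·I − R)(q⁻¹·I + R) = 0`. -/
def IsHecke (N : ℕ) (q : ℂ) (R : Matrix (Fin N × Fin N) (Fin N × Fin N) ℂ) : Prop :=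
  (q • (1 : Matrix (Fin N × Fin N) (Fin N × Fin N) ℂ) - R) * (q⁻¹ • 1 + R) = 0

/-- `q` is generic: `q ∉ {0, 1, −1}` and `qⁿ ≠ 1` for all positive integers `n`. -/
def GenericQ (q : ℂ) : Prop :=
  q ≠ 0 ∧ q ≠ 1 ∧ q ≠ -1 ∧ ∀ n : ℕ, 0 < n → q ^ n ≠ 1

/-- The reflection-equation type relation `R X₁ R X₁ = X₁ R X₁ R` in `Mat_{N²}`. -/
def RErel {α : Type*} [Semiring α] (N : ℕ)
    (R : Matrix (Fin N × Fin N) (Fin N × Fin N) α) (X : Matrix (Fin N) (Fin N) α) : Prop :=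
  opAt N 2 R 0 * matAt N 2 X 0 * opAt N 2 R 0 * matAt N 2 X 0 =
    matAt N 2 X 0 * opAt N 2 R 0 * matAt N 2 X 0 * opAt N 2 R 0

/-- The quantum-double permutation relation `D₁ R M₁ R = R M₁ R⁻¹ D₁ + R` in `Mat_{N²}(A)`. -/
def PermRel {A : Type*} [Ring A] [Algebra ℂ A] (N : ℕ)
    (R Rinv : Matrix (Fin N × Fin N) (Fin N × Fin N) ℂ)
    (M D : Matrix (Fin N) (Fin N) A) : Prop :=
  matAt N 2 D 0 * opAt N 2 (toA A R) 0 * matAt N 2 M 0 * opAt N 2 (toA A R) 0 =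
    opAt N 2 (toA A R) 0 * matAt N 2 M 0 * opAt N 2 (toA A Rinv) 0 * matAt N 2 D 0 +
      opAt N 2 (toA A R) 0

/-- The homogeneous permutation relation `D₁ R M₁ R = R M₁ R⁻¹ D₁` in `Mat_{N²}(A)`. -/
def PermRelHom {A : Type*} [Ring A] [Algebra ℂ A] (N : ℕ)
    (R Rinv : Matrix (Fin N × Fin N) (Fin N × Fin N) ℂ)
    (M D : Matrix (Fin N) (Fin N) A) : Prop :=
  matAt N 2 D 0 * opAt N 2 (toA A R) 0 * matAt N 2 M 0 * opAt N 2 (toA A R) 0 =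
    opAt N 2 (toA A R) 0 * matAt N 2 M 0 * opAt N 2 (toA A Rinv) 0 * matAt N 2 D 0

/-- Overline copies: `ovCopy … r = X_{⟨r+1⟩}`, i.e. `X_{⟨1⟩} = X⊗I⊗⋯⊗I` and
`X_{⟨r+1⟩} = R_r X_{⟨r⟩} R_r⁻¹`. -/
def ovCopy {α : Type*} [Semiring α] (N k : ℕ)
    (R Rinv : Matrix (Fin N × Fin N) (Fin N × Fin N) α)
    (X : Matrix (Fin N) (Fin N) α) : ℕ → Matrix (Fin k → Fin N) (Fin k → Fin N) α
  | 0 => matAt N k X 0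
  | r + 1 => opAt N k R r * ovCopy N k R Rinv X r * opAt N k Rinv r

/-- Underline copies: `unCopy … r = X_{[r+1]}`, i.e. `X_{[1]} = X⊗I⊗⋯⊗I` and
`X_{[r+1]} = R_r⁻¹ X_{[r]} R_r`. -/
def unCopy {α : Type*} [Semiring α] (N k : ℕ)
    (R Rinv : Matrix (Fin N × Fin N) (Fin N × Fin N) α)
    (X : Matrix (Fin N) (Fin N) α) : ℕ → Matrix (Fin k → Fin N) (Fin k → Fin N) α
  | 0 => matAt N k X 0
  | r + 1 => opAt N k Rinv r * unCopy N k R Rinv X r * opAt N k R r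

/-- `X_{⟨1→n⟩} = X_{⟨1⟩}X_{⟨2⟩}⋯X_{⟨n⟩}`. -/
def ovProd {α : Type*} [Semiring α] (N k : ℕ)
    (R Rinv : Matrix (Fin N × Fin N) (Fin N × Fin N) α)
    (X : Matrix (Fin N) (Fin N) α) (n : ℕ) : Matrix (Fin k → Fin N) (Fin k → Fin N) α :=
  ((List.range n).map (ovCopy N k R Rinv X)).prod

/-- `X_{⟨n→1⟩} = X_{⟨n⟩}X_{⟨n−1⟩}⋯X_{⟨1⟩}`. -/
def ovProdRev {α : Type*} [Semiring α] (N k : ℕ)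
    (R Rinv : Matrix (Fin N × Fin N) (Fin N × Fin N) α)
    (X : Matrix (Fin N) (Fin N) α) (n : ℕ) : Matrix (Fin k → Fin N) (Fin k → Fin N) α :=
  ((List.range n).reverse.map (ovCopy N k R Rinv X)).prod

/-- Shifted Jucys–Murphy matrices: `JMup … R n s = J_{s+1}^{↑n}`, i.e. `J₁^{↑n} = I` and
`J_{s+1}^{↑n} = R_{n+s} J_s^{↑n} R_{n+s}` (paper's 1-based `R_{n+s}` is `opAt … (n+s-1)`).
Applying it to `R⁻¹` produces `(J_{s+1}^{↑n})⁻¹`. -/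
def JMup {α : Type*} [Semiring α] (N k : ℕ)
    (R : Matrix (Fin N × Fin N) (Fin N × Fin N) α) (n : ℕ) :
    ℕ → Matrix (Fin k → Fin N) (Fin k → Fin N) α
  | 0 => 1
  | s + 1 => opAt N k R (n + s) * JMup N k R n s * opAt N k R (n + s)

/-- The quantum trace `Tr_{R(1…n)}(X) = Tr(C₁C₂⋯C_n X)`. -/
def qTr {α : Type*} [Semiring α] (N n : ℕ) (C : Matrix (Fin N) (Fin N) α)
    (X : Matrix (Fin n → Fin N) (Fin n → Fin N) α) : α :=
  Matrix.trace (((List.range n).map (matAt N n C)).prod * X)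

/-- The matrix `C`, `C_i^j = Σ_k Ψ_{ik}^{jk}`. -/
def traceMat (N : ℕ) (Ψ : Matrix (Fin N × Fin N) (Fin N × Fin N) ℂ) :
    Matrix (Fin N) (Fin N) ℂ :=
  Matrix.of fun i j => ∑ k, Ψ (i, k) (j, k)

/-- Skew-invertibility of `R`: `Tr₂(R₁₂Ψ₂₃) = Tr₂(Ψ₁₂R₂₃) = P₁₃`, written componentwise. -/
def SkewInv (N : ℕ) (R Ψ : Matrix (Fin N × Fin N) (Fin N × Fin N) ℂ) : Prop :=
  (∀ i k l n : Fin N, ∑ j, ∑ b, R (i, j) (l, b) * Ψ (b, k) (j, n) =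
      if i = n ∧ k = l then 1 else 0) ∧
  (∀ i k l n : Fin N, ∑ j, ∑ b, Ψ (i, j) (l, b) * R (b, k) (j, n) =
      if i = n ∧ k = l then 1 else 0)

/-- The generators `R₁, …, R_{n−1}` (1-based) of the Hecke-algebra image inside
`End(V^{⊗k})`, as a subset of `Mat_{N^k}`. -/
def genSet {α : Type*} [Semiring α] (N k n : ℕ)
    (R : Matrix (Fin N × Fin N) (Fin N × Fin N) α) :
    Set (Matrix (Fin k → Fin N) (Fin k → Fin N) α) :=
  {X | ∃ i : ℕ, i + 1 < n ∧ X = opAt N k R i}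

/-- The left ideal of `A` generated by the entries of `D`. -/
def entryIdeal (A : Type*) [Ring A] {N : ℕ} (D : Matrix (Fin N) (Fin N) A) :
    Submodule A A :=
  Submodule.span A {x : A | ∃ i j : Fin N, x = D i j}

/-- The normally ordered monomial `:L̂_{⟨1→k⟩}: = M_{⟨1→k⟩} D_{⟨k→1⟩} ∏_{s=1}^{k} J_s⁻¹`. -/
def normOrd {α : Type*} [Semiring α] (N k : ℕ)
    (R Rinv : Matrix (Fin N × Fin N) (Fin N × Fin N) α)
    (M D : Matrix (Fin N) (Fin N) α) (n : ℕ) :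
    Matrix (Fin k → Fin N) (Fin k → Fin N) α :=
  ovProd N k R Rinv M n * ovProdRev N k R Rinv D n *
    ((List.range n).map (fun s => JMup N k Rinv 0 s)).prod

/-! ### Conjugated copies in a ring with a braid group representation -/

section Abstract

variable {E : Type*} [Ring E]

/-- The copies `x, r₀ x r₀⁻¹, r₁ r₀ x r₀⁻¹ r₁⁻¹, …` of an element `x`. -/
def conjCopy (r : ℕ → Eˣ) (x : E) : ℕ → E
  | 0 => x
  | j + 1 => r j * conjCopy r x j * ↑(r j)⁻¹

/-- The product `x_a x_{a+1} ⋯ x_{a+l-1}` of consecutive copies of `x`. -/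
def conjProd (r : ℕ → Eˣ) (x : E) (a l : ℕ) : E :=
  ((List.range' a l).map (conjCopy r x)).prod

/-- The subring generated by the braid generators with index at least `a`. -/
def tailRing (r : ℕ → Eˣ) (a : ℕ) : Subring E :=
  Subring.closure {x | ∃ i, a ≤ i ∧ (x = r i ∨ x = ↑(r i)⁻¹)}

/-- The subring generated by the braid generators with index less than `b`. -/
def headRing (r : ℕ → Eˣ) (b : ℕ) : Subring E :=
  Subring.closure {x | ∃ i, i < b ∧ (x = r i ∨ x = ↑(r i)⁻¹)}

/-- The additive span of the elements `S x_a ⋯ x_{a+l-1} T` with `S` in the subring generated by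
the `r_i`, `a ≤ i`, and `T` in the subring generated by all `r_i`. -/
def sandwich (r : ℕ → Eˣ) (x : E) (a l : ℕ) : AddSubgroup E :=
  AddSubgroup.closure {y | ∃ S ∈ tailRing r a, ∃ T ∈ tailRing r 0, y = S * conjProd r x a l * T}

theorem conjProd_succ (r : ℕ → Eˣ) (x : E) (a l : ℕ) :
    conjProd r x a (l + 1) = conjCopy r x a * conjProd r x (a + 1) l := by
  simp [conjProd, List.range'_succ]

@[simp]
theorem conjProd_zero (r : ℕ → Eˣ) (x : E) (a : ℕ) : conjProd r x a 0 = 1 := by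
  simp [conjProd]

theorem mem_tailRing (r : ℕ → Eˣ) {a i : ℕ} (h : a ≤ i) : (r i : E) ∈ tailRing r a :=
  Subring.subset_closure ⟨i, h, Or.inl rfl⟩

theorem inv_mem_tailRing (r : ℕ → Eˣ) {a i : ℕ} (h : a ≤ i) :
    (↑(r i)⁻¹ : E) ∈ tailRing r a :=
  Subring.subset_closure ⟨i, h, Or.inr rfl⟩

theorem mem_headRing (r : ℕ → Eˣ) {b i : ℕ} (h : i < b) : (r i : E) ∈ headRing r b :=
  Subring.subset_closure ⟨i, h, Or.inl rfl⟩

theorem inv_mem_headRing (r : ℕ → Eˣ) {b i : ℕ} (h : i < b) :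
    (↑(r i)⁻¹ : E) ∈ headRing r b :=
  Subring.subset_closure ⟨i, h, Or.inr rfl⟩

theorem tailRing_anti (r : ℕ → Eˣ) {a b : ℕ} (h : a ≤ b) : tailRing r b ≤ tailRing r a :=
  Subring.closure_mono fun _ ⟨i, hi, hx⟩ => ⟨i, h.trans hi, hx⟩

theorem headRing_mono (r : ℕ → Eˣ) {a b : ℕ} (h : a ≤ b) : headRing r a ≤ headRing r b :=
  Subring.closure_mono fun _ ⟨i, hi, hx⟩ => ⟨i, hi.trans_le h, hx⟩

theorem headRing_le_tailRing (r : ℕ → Eˣ) (b : ℕ) : headRing r b ≤ tailRing r 0 :=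
  Subring.closure_mono fun _ ⟨i, _, hx⟩ => ⟨i, i.zero_le, hx⟩

theorem commute_of_mem_closure {s : Set E} {c x : E} (h : ∀ y ∈ s, Commute y c)
    (hx : x ∈ Subring.closure s) : Commute x c := by
  have : Subring.closure s ≤ Subring.centralizer {c} :=
    Subring.closure_le.2 fun y hy => by
      simpa [Subring.mem_centralizer_iff, Set.mem_centralizer_iff] using (h y hy).symm.eq
  have h' := this hx
  rw [Subring.mem_centralizer_iff] at h'
  exact (h' c rfl).symm

theorem commute_of_mem_tailRing {r : ℕ → Eˣ} {a : ℕ} {c x : E}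
    (h : ∀ i, a ≤ i → Commute (r i : E) c) (hx : x ∈ tailRing r a) : Commute x c := by
  refine commute_of_mem_closure ?_ hx
  rintro _ ⟨i, hi, rfl | rfl⟩
  · exact h i hi
  · exact (h i hi).units_inv_left

theorem commute_of_mem_headRing {r : ℕ → Eˣ} {b : ℕ} {c x : E}
    (h : ∀ i, i < b → Commute (r i : E) c) (hx : x ∈ headRing r b) : Commute x c := by
  refine commute_of_mem_closure ?_ hx
  rintro _ ⟨i, hi, rfl | rfl⟩
  · exact h i hi
  · exact (h i hi).units_inv_left

/-- The units `r₀, …, r_{n-2}` satisfy the braid relations, and units with distant indices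
commute. -/
structure IsBraidFamily (n : ℕ) (r : ℕ → Eˣ) : Prop where
  braid : ∀ i, i + 2 < n → (r i : E) * r (i + 1) * r i = r (i + 1) * r i * r (i + 1)
  far : ∀ i j, i + 1 < j → Commute (r i : E) (r j)

namespace IsBraidFamily

variable {n : ℕ} {r : ℕ → Eˣ}

theorem commute_conjCopy_of_lt (hr : IsBraidFamily n r) {x : E}
    (hx : ∀ i, 1 ≤ i → Commute (r i : E) x) {i j : ℕ} (h : j < i) :
    Commute (r i : E) (conjCopy r x j) := by
  induction j with
  | zero => exact hx i h
  | succ j ih =>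
    have hc := (hr.far j i h).symm
    exact (hc.mul_right (ih (by omega))).mul_right hc.units_inv_right

theorem commute_conjCopy_of_gt (hr : IsBraidFamily n r) {x : E}
    (hx : ∀ i, 1 ≤ i → Commute (r i : E) x) {i j : ℕ} (h : i + 1 < j) (hj : j < n) :
    Commute (r i : E) (conjCopy r x j) := by
  induction j, h using Nat.le_induction with
  | base =>
    have hb := hr.braid i hj
    have hc := hr.commute_conjCopy_of_lt hx (Nat.lt_succ_self i)
    have hb' : (↑(r i)⁻¹ * ↑(r (i + 1))⁻¹ * r i : E) =
        r (i + 1) * ↑(r i)⁻¹ * ↑(r (i + 1))⁻¹ := by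
      have hu : r i * r (i + 1) * r i = r (i + 1) * r i * r (i + 1) := Units.ext (by simpa using hb)
      have : (r i)⁻¹ * (r (i + 1))⁻¹ * r i = r (i + 1) * (r i)⁻¹ * (r (i + 1))⁻¹ := by
        rw [eq_mul_inv_iff_mul_eq, eq_mul_inv_iff_mul_eq, mul_assoc, mul_assoc, mul_assoc,
          inv_mul_eq_iff_eq_mul, inv_mul_eq_iff_eq_mul, ← mul_assoc, ← mul_assoc, hu]
      simpa using congrArg (Units.val) this
    change r i * (r (i + 1) * (r i * conjCopy r x i * ↑(r i)⁻¹) * ↑(r (i + 1))⁻¹) =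
      (r (i + 1) * (r i * conjCopy r x i * ↑(r i)⁻¹) * ↑(r (i + 1))⁻¹) * (r i : E)
    calc (r i * (r (i + 1) * (r i * conjCopy r x i * ↑(r i)⁻¹) * ↑(r (i + 1))⁻¹) : E)
        = (r i * r (i + 1) * r i) * conjCopy r x i * ↑(r i)⁻¹ * ↑(r (i + 1))⁻¹ := by
          simp only [mul_assoc]
      _ = r (i + 1) * r i * (r (i + 1) * conjCopy r x i) * ↑(r i)⁻¹ * ↑(r (i + 1))⁻¹ := by
          rw [hb]; simp only [mul_assoc]
      _ = r (i + 1) * r i * conjCopy r x i * (r (i + 1) * ↑(r i)⁻¹ * ↑(r (i + 1))⁻¹) := by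
          rw [hc.eq]; simp only [mul_assoc]
      _ = _ := by rw [← hb']; simp only [mul_assoc]
  | succ j hij ih =>
    have hc := hr.far i j hij
    exact (hc.mul_right (ih (by omega))).mul_right hc.units_inv_right

theorem commute_conjProd_of_gt (hr : IsBraidFamily n r) {x : E}
    (hx : ∀ i, 1 ≤ i → Commute (r i : E) x) {i a l : ℕ} (h : i + 1 < a) (hal : a + l ≤ n) :
    Commute (r i : E) (conjProd r x a l) := by
  refine Commute.list_prod_right _ _ fun y hy => ?_
  obtain ⟨j, hj, rfl⟩ := List.mem_map.1 hy
  rw [List.mem_range'_1] at hj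
  exact hr.commute_conjCopy_of_gt hx (by omega) (by omega)

end IsBraidFamily

theorem conjCopy_mem (r : ℕ → Eˣ) {y : E} {L : AddSubgroup E}
    (hl : ∀ z, ∀ w ∈ L, z * w ∈ L) (hR : ∀ w ∈ L, ∀ T ∈ tailRing r 0, w * T ∈ L) (hyL : y ∈ L)
    (a : ℕ) : conjCopy r y a ∈ L := by
  induction a with
  | zero => exact hyL
  | succ a ih => exact hR _ (hl _ _ ih) _ (inv_mem_tailRing r a.zero_le)

theorem conjProd_mem_sandwich (r : ℕ → Eˣ) (x : E) (a l : ℕ) :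
    conjProd r x a l ∈ sandwich r x a l :=
  AddSubgroup.subset_closure ⟨1, one_mem _, 1, one_mem _, by simp⟩

theorem map_mem_of_mem_sandwich {r : ℕ → Eˣ} {x : E} {a l : ℕ} (f : E →+ E) {K : AddSubgroup E}
    (h : ∀ S ∈ tailRing r a, ∀ T ∈ tailRing r 0, f (S * conjProd r x a l * T) ∈ K) {y : E}
    (hy : y ∈ sandwich r x a l) : f y ∈ K := by
  have : sandwich r x a l ≤ K.comap f := by
    refine (AddSubgroup.closure_le _).2 ?_
    rintro _ ⟨S, hS, T, hT, rfl⟩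
    exact h S hS T hT
  exact this hy

theorem mul_mem_sandwich_left {r : ℕ → Eˣ} {x : E} {a l : ℕ} {S y : E} (hS : S ∈ tailRing r a)
    (hy : y ∈ sandwich r x a l) : S * y ∈ sandwich r x a l :=
  map_mem_of_mem_sandwich (K := sandwich r x a l) (AddMonoidHom.mulLeft S) (fun S' hS' T hT =>
    AddSubgroup.subset_closure ⟨S * S', mul_mem hS hS', T, hT, by simp [mul_assoc]⟩) hy

theorem mul_mem_sandwich_right {r : ℕ → Eˣ} {x : E} {a l : ℕ} {T y : E} (hT : T ∈ tailRing r 0)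
    (hy : y ∈ sandwich r x a l) : y * T ∈ sandwich r x a l :=
  map_mem_of_mem_sandwich (K := sandwich r x a l) (AddMonoidHom.mulRight T) (fun S hS T' hT' =>
    AddSubgroup.subset_closure ⟨S, hS, T' * T, mul_mem hT' hT, by simp [mul_assoc]⟩) hy

namespace IsBraidFamily

variable {n : ℕ} {r : ℕ → Eˣ}

theorem conjCopy_mul_mem_sandwich (hr : IsBraidFamily n r) {x : E}
    (hx : ∀ i, 1 ≤ i → Commute (r i : E) x) {a l : ℕ} {y : E}
    (hy : y ∈ sandwich r x (a + 1) l) : conjCopy r x a * y ∈ sandwich r x a (l + 1) := by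
  refine map_mem_of_mem_sandwich (K := sandwich r x a (l + 1))
    (AddMonoidHom.mulLeft (conjCopy r x a)) (fun S hS T hT => AddSubgroup.subset_closure
      ⟨S, tailRing_anti r a.le_succ hS, T, hT, ?_⟩) hy
  have hc : Commute S (conjCopy r x a) :=
    commute_of_mem_tailRing (fun i hi => hr.commute_conjCopy_of_lt hx hi) hS
  simp only [AddMonoidHom.coe_mulLeft, conjProd_succ, ← mul_assoc, hc.eq]

theorem conjProd_succ_mem_sandwich (hr : IsBraidFamily n r) {x : E}
    (hx : ∀ i, 1 ≤ i → Commute (r i : E) x) (l : ℕ) {a : ℕ} (h : a + 1 + l ≤ n) :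
    conjProd r x (a + 1) l ∈ sandwich r x a l := by
  induction l generalizing a with
  | zero => simpa using conjProd_mem_sandwich r x a 0
  | succ l ih =>
    have hc : Commute (↑(r a)⁻¹ : E) (conjProd r x (a + 1 + 1) l) :=
      (hr.commute_conjProd_of_gt hx (by omega) (by omega)).units_inv_left
    have key : conjProd r x (a + 1) (l + 1) =
        r a * (conjCopy r x a * conjProd r x (a + 1 + 1) l) * ↑(r a)⁻¹ := by
      rw [conjProd_succ, conjCopy, mul_assoc _ (↑(r a)⁻¹ : E), hc.eq]
      simp only [mul_assoc]
    rw [key]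
    exact mul_mem_sandwich_right (inv_mem_tailRing r a.zero_le)
      (mul_mem_sandwich_left (mem_tailRing r le_rfl)
        (hr.conjCopy_mul_mem_sandwich hx (ih (by omega))))

theorem sandwich_succ_le (hr : IsBraidFamily n r) {x : E}
    (hx : ∀ i, 1 ≤ i → Commute (r i : E) x) {a l : ℕ} (h : a + 1 + l ≤ n) :
    sandwich r x (a + 1) l ≤ sandwich r x a l := by
  refine (AddSubgroup.closure_le _).2 ?_
  rintro _ ⟨S, hS, T, hT, rfl⟩
  exact mul_mem_sandwich_right hT (mul_mem_sandwich_left (tailRing_anti r a.le_succ hS)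
    (hr.conjProd_succ_mem_sandwich hx l h))

/-- The permutation relation between neighbouring copies. -/
theorem conjCopy_mul_conjCopy_succ (hr : IsBraidFamily n r) {x y : E}
    (hx : ∀ i, 1 ≤ i → Commute (r i : E) x) (hy : ∀ i, 1 ≤ i → Commute (r i : E) y)
    (hperm : y * r 0 * x * r 0 = r 0 * x * ↑(r 0)⁻¹ * y + r 0) {a : ℕ} (ha : a + 1 < n) :
    conjCopy r y a * conjCopy r x (a + 1) =
      conjCopy r x (a + 1) * conjCopy r y a * (↑(r a)⁻¹ * ↑(r a)⁻¹) + ↑(r a)⁻¹ := by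
  induction a with
  | zero =>
    have h := congrArg (fun z : E => z * ↑(r 0)⁻¹ * ↑(r 0)⁻¹) hperm
    simp only [add_mul, Units.mul_inv_cancel_right, Units.mul_inv, one_mul] at h
    simpa [conjCopy, mul_assoc] using h
  | succ a ih =>
    have hy1 : (r a * r (a + 1) : E) * conjCopy r y a =
        conjCopy r y (a + 1) * (r a * r (a + 1)) := by
      have := (hr.commute_conjCopy_of_lt hy (Nat.lt_succ_self a)).eq
      simp only [conjCopy, mul_assoc, Units.inv_mul_cancel_left, this]
    have hx1 : (r a * r (a + 1) : E) * conjCopy r x (a + 1) =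
        conjCopy r x (a + 2) * (r a * r (a + 1)) := by
      have := (hr.commute_conjCopy_of_gt hx (Nat.lt_succ_self (a + 1)) ha).eq
      rw [← mul_assoc (conjCopy r x (a + 2)), ← this, conjCopy.eq_2 r x (a + 1)]
      simp only [mul_assoc, Units.inv_mul, mul_one]
    have hs : (r a * r (a + 1) : E) * ↑(r a)⁻¹ = ↑(r (a + 1))⁻¹ * (r a * r (a + 1)) := by
      rw [Units.mul_inv_eq_iff_eq_mul, mul_assoc _ _ (r a : E), hr.braid a ha,
        mul_assoc (r (a + 1) : E), Units.inv_mul_cancel_left]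
    have hss : (r a * r (a + 1) : E) * (↑(r a)⁻¹ * ↑(r a)⁻¹) =
        ↑(r (a + 1))⁻¹ * ↑(r (a + 1))⁻¹ * (r a * r (a + 1)) := by
      rw [← mul_assoc, hs, mul_assoc, hs, mul_assoc]
    refine (Units.mul_left_inj (r a * r (a + 1))).1 ?_
    simp only [Units.val_mul]
    calc conjCopy r y (a + 1) * conjCopy r x (a + 2) * (r a * r (a + 1))
        = r a * r (a + 1) * (conjCopy r y a * conjCopy r x (a + 1)) := by
          rw [mul_assoc, ← hx1, ← mul_assoc, ← hy1, mul_assoc]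
      _ = r a * r (a + 1) * conjCopy r x (a + 1) * conjCopy r y a * ↑(r a)⁻¹ * ↑(r a)⁻¹ +
            r a * r (a + 1) * ↑(r a)⁻¹ := by
          rw [ih (by omega), mul_add]; simp only [mul_assoc]
      _ = _ := by
          rw [hx1, mul_assoc (conjCopy r x (a + 2)), hy1, ← mul_assoc (conjCopy r x (a + 2)),
            mul_assoc _ (↑(r a)⁻¹ : E), mul_assoc _ _ (↑(r a)⁻¹ * ↑(r a)⁻¹ : E), hss, hs, add_mul]
          simp only [mul_assoc]

theorem exists_conjCopy_mul_conjCopy (hr : IsBraidFamily n r) {x y : E}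
    (hx : ∀ i, 1 ≤ i → Commute (r i : E) x) (hy : ∀ i, 1 ≤ i → Commute (r i : E) y)
    (hperm : y * r 0 * x * r 0 = r 0 * x * ↑(r 0)⁻¹ * y + r 0) {a b : ℕ} (hab : a < b)
    (hb : b < n) :
    ∃ g ∈ headRing r b, ∃ h ∈ headRing r b,
      conjCopy r y a * conjCopy r x b = conjCopy r x b * conjCopy r y a * g + h := by
  induction b, hab using Nat.le_induction with
  | base =>
    have hi := inv_mem_headRing r (Nat.lt_succ_self a)
    exact ⟨_, mul_mem hi hi, _, hi, hr.conjCopy_mul_conjCopy_succ hx hy hperm hb⟩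
  | succ b hab ih =>
    obtain ⟨g, hg, h, hh, e⟩ := ih (by omega)
    have hr1 := mem_headRing r (Nat.lt_succ_self b)
    have hr2 := inv_mem_headRing r (Nat.lt_succ_self b)
    have hc := hr.commute_conjCopy_of_lt hy hab
    refine ⟨r b * g * ↑(r b)⁻¹, mul_mem (mul_mem hr1 (headRing_mono r b.le_succ hg)) hr2,
      r b * h * ↑(r b)⁻¹, mul_mem (mul_mem hr1 (headRing_mono r b.le_succ hh)) hr2, ?_⟩
    calc conjCopy r y a * conjCopy r x (b + 1)
        = (conjCopy r y a * r b) * conjCopy r x b * ↑(r b)⁻¹ := by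
          simp only [conjCopy, mul_assoc]
      _ = r b * (conjCopy r y a * conjCopy r x b) * ↑(r b)⁻¹ := by
          rw [← hc.eq]; simp only [mul_assoc]
      _ = r b * conjCopy r x b * conjCopy r y a * g * ↑(r b)⁻¹ + r b * h * ↑(r b)⁻¹ := by
          rw [e]; simp only [mul_add, add_mul, mul_assoc]
      _ = r b * conjCopy r x b * (↑(r b)⁻¹ * (r b * conjCopy r y a)) * g * ↑(r b)⁻¹ +
            r b * h * ↑(r b)⁻¹ := by
          rw [Units.inv_mul_cancel_left]
      _ = _ := by rw [hc.eq]; simp only [conjCopy, mul_assoc]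

theorem conjCopy_mul_conjProd_mem (hr : IsBraidFamily n r) {x y : E}
    (hx : ∀ i, 1 ≤ i → Commute (r i : E) x) (hy : ∀ i, 1 ≤ i → Commute (r i : E) y)
    (hperm : y * r 0 * x * r 0 = r 0 * x * ↑(r 0)⁻¹ * y + r 0) {L : AddSubgroup E}
    (hl : ∀ z, ∀ w ∈ L, z * w ∈ L) (hR : ∀ w ∈ L, ∀ T ∈ tailRing r 0, w * T ∈ L) (hyL : y ∈ L)
    (l : ℕ) {a b : ℕ} (hab : a < b) (hb : b + (l + 1) ≤ n) :
    conjCopy r y a * conjProd r x b (l + 1) ∈ sandwich r x b l ⊔ L := by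
  induction l generalizing b with
  | zero =>
    obtain ⟨g, hg, h, hh, e⟩ := hr.exists_conjCopy_mul_conjCopy hx hy hperm hab (by omega)
    rw [conjProd_succ, conjProd_zero, mul_one, e, add_comm]
    refine AddSubgroup.add_mem_sup ?_ ?_
    · exact AddSubgroup.subset_closure
        ⟨1, one_mem _, h, headRing_le_tailRing r b hh, by simp⟩
    · exact hR _ (hl _ _ (conjCopy_mem r hl hR hyL a)) _ (headRing_le_tailRing r b hg)
  | succ l ih =>
    obtain ⟨g, hg, h, hh, e⟩ := hr.exists_conjCopy_mul_conjCopy hx hy hperm hab (by omega)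
    have hc : ∀ z ∈ headRing r b, Commute z (conjProd r x (b + 1) (l + 1)) := fun z hz =>
      commute_of_mem_headRing
        (fun i hi => hr.commute_conjProd_of_gt hx (by omega) (by omega)) hz
    have key : conjCopy r y a * conjProd r x b (l + 1 + 1) =
        conjCopy r x b * (conjCopy r y a * conjProd r x (b + 1) (l + 1)) * g +
          conjProd r x (b + 1) (l + 1) * h := by
      rw [conjProd_succ, ← mul_assoc, e, add_mul, (hc h hh).eq, mul_assoc _ g, (hc g hg).eq]
      simp only [mul_assoc]
    rw [key]
    refine add_mem ?_ (AddSubgroup.mem_sup_left (mul_mem_sandwich_right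
      (headRing_le_tailRing r b hh) (hr.conjProd_succ_mem_sandwich hx _ (by omega))))
    obtain ⟨u, hu, v, hv, huv⟩ := AddSubgroup.mem_sup.1 (ih (b := b + 1) (by omega) (by omega))
    rw [← huv, mul_add, add_mul]
    have hg' := headRing_le_tailRing r b hg
    exact AddSubgroup.add_mem_sup
      (mul_mem_sandwich_right hg' (hr.conjCopy_mul_mem_sandwich hx hu)) (hR _ (hl _ _ hv) _ hg')

theorem conjCopy_mul_mem (hr : IsBraidFamily n r) {x y : E}
    (hx : ∀ i, 1 ≤ i → Commute (r i : E) x) (hy : ∀ i, 1 ≤ i → Commute (r i : E) y)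
    (hperm : y * r 0 * x * r 0 = r 0 * x * ↑(r 0)⁻¹ * y + r 0) {L : AddSubgroup E}
    (hl : ∀ z, ∀ w ∈ L, z * w ∈ L) (hR : ∀ w ∈ L, ∀ T ∈ tailRing r 0, w * T ∈ L) (hyL : y ∈ L)
    {a l : ℕ} (ha : a + 1 + (l + 1) ≤ n) {z : E} (hz : z ∈ sandwich r x (a + 1) (l + 1)) :
    conjCopy r y a * z ∈ sandwich r x a l ⊔ L := by
  refine map_mem_of_mem_sandwich (AddMonoidHom.mulLeft (conjCopy r y a)) (fun S hS T hT => ?_) hz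
  have hc : Commute S (conjCopy r y a) :=
    commute_of_mem_tailRing (fun i hi => hr.commute_conjCopy_of_lt hy hi) hS
  have key : conjCopy r y a * (S * conjProd r x (a + 1) (l + 1) * T) =
      S * (conjCopy r y a * conjProd r x (a + 1) (l + 1)) * T := by
    simp only [← mul_assoc, hc.eq]
  rw [AddMonoidHom.coe_mulLeft, key]
  obtain ⟨u, hu, v, hv, huv⟩ := AddSubgroup.mem_sup.1
    (hr.conjCopy_mul_conjProd_mem hx hy hperm hl hR hyL l a.lt_succ_self ha)
  rw [← huv, mul_add, add_mul]
  exact AddSubgroup.add_mem_sup (hr.sandwich_succ_le hx (by omega)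
    (mul_mem_sandwich_right hT (mul_mem_sandwich_left hS hu))) (hR _ (hl _ _ hv) _ hT)

theorem conjCopy_mul_mem_of_zero (hr : IsBraidFamily n r) {x y : E}
    (hy : ∀ i, 1 ≤ i → Commute (r i : E) y) {L : AddSubgroup E}
    (hl : ∀ z, ∀ w ∈ L, z * w ∈ L) (hR : ∀ w ∈ L, ∀ T ∈ tailRing r 0, w * T ∈ L) (hyL : y ∈ L)
    {a : ℕ} {z : E} (hz : z ∈ sandwich r x (a + 1) 0) :
    conjCopy r y a * z ∈ L := by
  refine map_mem_of_mem_sandwich (AddMonoidHom.mulLeft (conjCopy r y a)) (fun S hS T hT => ?_) hz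
  have hc : Commute S (conjCopy r y a) :=
    commute_of_mem_tailRing (fun i hi => hr.commute_conjCopy_of_lt hy hi) hS
  have key : conjCopy r y a * (S * conjProd r x (a + 1) 0 * T) = S * conjCopy r y a * T := by
    rw [conjProd_zero, mul_one, ← mul_assoc, hc.eq]
  rw [AddMonoidHom.coe_mulLeft, key]
  exact hR _ (hl _ _ (conjCopy_mem r hl hR hyL a)) _ hT

/-- Multiplication by `y₀ ⋯ y_{m-1}` lowers the number of copies of `x` by `m`, modulo `L`. -/
theorem prod_conjCopy_mul_mem (hr : IsBraidFamily n r) {x y : E}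
    (hx : ∀ i, 1 ≤ i → Commute (r i : E) x) (hy : ∀ i, 1 ≤ i → Commute (r i : E) y)
    (hperm : y * r 0 * x * r 0 = r 0 * x * ↑(r 0)⁻¹ * y + r 0) {L : AddSubgroup E}
    (hl : ∀ z, ∀ w ∈ L, z * w ∈ L) (hR : ∀ w ∈ L, ∀ T ∈ tailRing r 0, w * T ∈ L) (hyL : y ∈ L)
    {m k : ℕ} (hmk : m + k ≤ n) {z : E} (hz : z ∈ sandwich r x m k) :
    (m ≤ k → ((List.range m).map (conjCopy r y)).prod * z ∈ sandwich r x 0 (k - m) ⊔ L) ∧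
      (k < m → ((List.range m).map (conjCopy r y)).prod * z ∈ L) := by
  induction m generalizing k z with
  | zero => exact ⟨fun _ => by simpa using AddSubgroup.mem_sup_left hz, fun h => by omega⟩
  | succ m ih =>
    simp only [List.range_succ, List.map_append, List.map_cons, List.map_nil, List.prod_append,
      List.prod_singleton, mul_assoc]
    cases k with
    | zero =>
      exact ⟨fun h => by omega, fun _ => hl _ _ (hr.conjCopy_mul_mem_of_zero hy hl hR hyL hz)⟩
    | succ k =>
      obtain ⟨u, hu, v, hv, huv⟩ := AddSubgroup.mem_sup.1
        (hr.conjCopy_mul_mem hx hy hperm hl hR hyL hmk hz)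
      obtain ⟨h1, h2⟩ := ih (by omega) hu
      rw [← huv, mul_add, Nat.add_sub_add_right]
      exact ⟨fun h => add_mem (h1 (by omega)) (AddSubgroup.mem_sup_right (hl _ _ hv)),
        fun h => add_mem (h2 (by omega)) (hl _ _ hv)⟩

end IsBraidFamily

end Abstract

/-! ### Embedding operators acting on a window of tensor factors -/

section Window

variable {α : Type*} [Semiring α] {N n p p' : ℕ}

/-- The operator `K` on `V^{⊗p}` acting on the tensor factors of `V^{⊗n}` selected by `f`. -/
def windowEmb (f : Fin p → Fin n) (K : Matrix (Fin p → Fin N) (Fin p → Fin N) α) :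
    Matrix (Fin n → Fin N) (Fin n → Fin N) α :=
  Matrix.of fun a b => if ∀ l, (∀ j, f j ≠ l) → a l = b l then K (a ∘ f) (b ∘ f) else 0

/-- The inclusion of the `p` consecutive positions starting at `i`. -/
def window {i : ℕ} (h : i + p ≤ n) (l : Fin p) : Fin n := ⟨i + l, by omega⟩

theorem window_injective {i : ℕ} (h : i + p ≤ n) : Function.Injective (window h) := by
  intro a b hab
  simpa [window, Fin.ext_iff] using hab

theorem extend_comp_injective {f : Fin p → Fin n} (hf : f.Injective) (a : Fin n → Fin N) :
    Function.Injective fun c : Fin p → Fin N => Function.extend f c a := fun c c' h => by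
  have := congrArg (· ∘ f) h
  simpa [Function.extend_comp hf] using this

theorem extend_eq_of_off {f : Fin p → Fin n} (hf : f.Injective) {a c : Fin n → Fin N}
    (h : ∀ l, (∀ j, f j ≠ l) → a l = c l) : Function.extend f (c ∘ f) a = c := by
  funext l
  by_cases hl : ∃ j, f j = l
  · obtain ⟨j, rfl⟩ := hl
    simp [hf.extend_apply]
  · rw [Function.extend_apply' _ _ _ hl, h l (by simpa using hl)]

theorem windowEmb_mul {f : Fin p → Fin n} (hf : f.Injective)
    (K L : Matrix (Fin p → Fin N) (Fin p → Fin N) α) :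
    windowEmb f (K * L) = windowEmb f K * windowEmb f L := by
  ext a b
  simp only [windowEmb, Matrix.of_apply, Matrix.mul_apply]
  rw [← Fintype.sum_of_injective _ (extend_comp_injective hf a)
    (fun c => if ∀ l, (∀ j, f j ≠ l) → a l = b l then K (a ∘ f) c * L c (b ∘ f) else 0)]
  · split_ifs <;> simp
  · intro c hc
    rw [if_neg, zero_mul]
    exact fun h => hc ⟨c ∘ f, extend_eq_of_off hf h⟩
  · intro c
    have h1 : ∀ l, (∀ j, f j ≠ l) → Function.extend f c a l = a l := fun l hl =>
      Function.extend_apply' _ _ _ (by simpa using hl)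
    rw [if_pos fun l hl => (h1 l hl).symm, Function.extend_comp hf]
    have h2 : (∀ l, (∀ j, f j ≠ l) → Function.extend f c a l = b l) ↔
        ∀ l, (∀ j, f j ≠ l) → a l = b l :=
      forall₂_congr fun l hl => by rw [h1 l hl]
    simp only [h2, mul_ite, mul_zero]

theorem windowEmb_mul_apply_of_disjoint {f : Fin p → Fin n} {g : Fin p' → Fin n}
    (hf : f.Injective) (hfg : ∀ i j, f i ≠ g j)
    (K : Matrix (Fin p → Fin N) (Fin p → Fin N) α)
    (L : Matrix (Fin p' → Fin N) (Fin p' → Fin N) α) (a b : Fin n → Fin N) :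
    (windowEmb f K * windowEmb g L) a b =
      if ∀ l, (∀ j, f j ≠ l) → (∀ j, g j ≠ l) → a l = b l then
        K (a ∘ f) (b ∘ f) * L (a ∘ g) (b ∘ g) else 0 := by
  have hoff : ∀ l, (∀ j, f j ≠ l) → Function.extend f (b ∘ f) a l = a l := fun l hl =>
    Function.extend_apply' _ _ _ (by simpa using hl)
  have hon : Function.extend f (b ∘ f) a ∘ g = a ∘ g := funext fun j => hoff _ fun i => hfg i j
  rw [Matrix.mul_apply, Finset.sum_eq_single (Function.extend f (b ∘ f) a)]
  · simp only [windowEmb, Matrix.of_apply]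
    rw [if_pos fun l hl => (hoff l hl).symm, Function.extend_comp hf, hon]
    have h : (∀ l, (∀ j, g j ≠ l) → Function.extend f (b ∘ f) a l = b l) ↔
        ∀ l, (∀ j, f j ≠ l) → (∀ j, g j ≠ l) → a l = b l := by
      refine forall_congr' fun l => ?_
      by_cases hl : ∃ j, f j = l
      · obtain ⟨j, rfl⟩ := hl
        simp [hf.extend_apply]
      · have hl' : ∀ j, f j ≠ l := by simpa using hl
        simp [hl']
    simp only [h, mul_ite, mul_zero]
  · intro c _ hc
    simp only [windowEmb, Matrix.of_apply]
    split_ifs with h1 h2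
    · refine absurd ?_ hc
      rw [← extend_eq_of_off hf h1]
      congr 1
      exact funext fun j => h2 _ fun i => (hfg j i).symm
    all_goals simp
  · simp

theorem commute_windowEmb {f : Fin p → Fin n} {g : Fin p' → Fin n}
    (hf : f.Injective) (hg : g.Injective) (hfg : ∀ i j, f i ≠ g j)
    {K : Matrix (Fin p → Fin N) (Fin p → Fin N) α}
    {L : Matrix (Fin p' → Fin N) (Fin p' → Fin N) α}
    (h : ∀ a b c d, Commute (K a b) (L c d)) : Commute (windowEmb f K) (windowEmb g L) := by
  refine Matrix.ext fun a b => ?_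
  rw [windowEmb_mul_apply_of_disjoint hf hfg,
    windowEmb_mul_apply_of_disjoint hg fun i j => (hfg j i).symm, (h _ _ _ _).eq]
  refine if_congr (forall_congr' fun l => ?_) rfl rfl
  tauto

theorem opAt_add (R : Matrix (Fin N × Fin N) (Fin N × Fin N) α) {i j : ℕ} (h : i + p ≤ n)
    (hj : j + 1 < p) : opAt N n R (i + j) = windowEmb (window h) (opAt N p R j) := by
  ext a b
  have hc : (∀ l : Fin n, (l : ℕ) ≠ i + j → (l : ℕ) ≠ i + j + 1 → a l = b l) ↔
      (∀ l, (∀ k, window h k ≠ l) → a l = b l) ∧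
        ∀ l : Fin p, (l : ℕ) ≠ j → (l : ℕ) ≠ j + 1 → a (window h l) = b (window h l) := by
    constructor
    · refine fun H => ⟨fun l hl => H l (fun e => hl ⟨j, by omega⟩ (Fin.ext e.symm))
        (fun e => hl ⟨j + 1, hj⟩ (Fin.ext e.symm)), fun l h1 h2 => H _ ?_ ?_⟩ <;>
      simp only [window] <;> omega
    · rintro ⟨H1, H2⟩ l h1 h2
      by_cases hl : ∃ k, window h k = l
      · obtain ⟨k, rfl⟩ := hl
        simp only [window] at h1 h2
        exact H2 k (by omega) (by omega)
      · exact H1 l (by simpa using hl)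
  rw [opAt, dif_pos (by omega), opAt, dif_pos hj]
  simp only [windowEmb, Matrix.of_apply, hc, ite_and, Function.comp_apply]
  rfl

theorem matAt_add (X : Matrix (Fin N) (Fin N) α) {i j : ℕ} (h : i + p ≤ n)
    (hj : j < p) : matAt N n X (i + j) = windowEmb (window h) (matAt N p X j) := by
  ext a b
  have hc : (∀ l : Fin n, (l : ℕ) ≠ i + j → a l = b l) ↔
      (∀ l, (∀ k, window h k ≠ l) → a l = b l) ∧
        ∀ l : Fin p, (l : ℕ) ≠ j → a (window h l) = b (window h l) := by
    constructor
    · refine fun H => ⟨fun l hl => H l (fun e => hl ⟨j, by omega⟩ (Fin.ext e.symm)),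
        fun l h1 => H _ ?_⟩
      simp only [window]
      omega
    · rintro ⟨H1, H2⟩ l h1
      by_cases hl : ∃ k, window h k = l
      · obtain ⟨k, rfl⟩ := hl
        simp only [window] at h1
        exact H2 k (by omega)
      · exact H1 l (by simpa using hl)
  rw [matAt, dif_pos (by omega), matAt, dif_pos hj]
  simp only [windowEmb, Matrix.of_apply, hc, ite_and, Function.comp_apply]
  rfl

theorem windowEmb_add (f : Fin p → Fin n) (K L : Matrix (Fin p → Fin N) (Fin p → Fin N) α) :
    windowEmb f (K + L) = windowEmb f K + windowEmb f L := by
  ext a b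
  simp only [windowEmb, Matrix.of_apply, Matrix.add_apply]
  split_ifs <;> simp

theorem opAt_two (R : Matrix (Fin N × Fin N) (Fin N × Fin N) α) :
    opAt N 2 R 0 = R.submatrix (finTwoArrowEquiv (Fin N)) (finTwoArrowEquiv (Fin N)) := by
  ext a b
  rw [opAt, dif_pos (by omega), Matrix.of_apply, if_pos fun l h0 h1 => by omega]
  rfl

theorem opAt_of_le (R : Matrix (Fin N × Fin N) (Fin N × Fin N) α) {i : ℕ} (h : n ≤ i + 1) :
    opAt N n R i = 1 :=
  dif_neg (by omega)

theorem opAt_mul (R S : Matrix (Fin N × Fin N) (Fin N × Fin N) α) (i : ℕ) :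
    opAt N n (R * S) i = opAt N n R i * opAt N n S i := by
  by_cases h : i + 2 ≤ n
  · have key (X : Matrix (Fin N × Fin N) (Fin N × Fin N) α) :=
      opAt_add (j := 0) X h (by omega)
    simp only [add_zero] at key
    rw [key, key, key, ← windowEmb_mul (window_injective h), opAt_two, opAt_two, opAt_two,
      Matrix.submatrix_mul_equiv]
  · simp [opAt_of_le (n := n) _ (show n ≤ i + 1 by omega)]

theorem opAt_one (i : ℕ) : opAt N n (1 : Matrix (Fin N × Fin N) (Fin N × Fin N) α) i = 1 := by
  by_cases h : i + 1 < n
  · ext a b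
    rw [opAt, dif_pos h, Matrix.of_apply]
    by_cases hab : a = b
    · subst hab
      rw [if_pos fun _ _ _ => rfl, Matrix.one_apply_eq, Matrix.one_apply_eq]
    · rw [Matrix.one_apply_ne hab]
      split_ifs with H
      · refine Matrix.one_apply_ne fun e => hab (funext fun l => ?_)
        rw [Prod.mk.injEq] at e
        by_cases h0 : (l : ℕ) = i
        · convert e.1
        · by_cases h1 : (l : ℕ) = i + 1
          · convert e.2
          · exact H l h0 h1
      · rfl
  · exact opAt_of_le _ (by omega)

end Window

section EntryIdeal

variable {A : Type*} [Ring A] {N n : ℕ}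

/-- The matrices all of whose entries lie in the left ideal generated by the entries of `D`. -/
def entryIdealMatrix (D : Matrix (Fin N) (Fin N) A) (n : ℕ) :
    AddSubgroup (Matrix (Fin n → Fin N) (Fin n → Fin N) A) where
  carrier := {X | ∀ a b, X a b ∈ entryIdeal A D}
  zero_mem' _ _ := zero_mem _
  add_mem' hX hY a b := add_mem (hX a b) (hY a b)
  neg_mem' hX a b := neg_mem (hX a b)

theorem mul_mem_entryIdealMatrix {D : Matrix (Fin N) (Fin N) A}
    (Z : Matrix (Fin n → Fin N) (Fin n → Fin N) A) :
    ∀ W ∈ entryIdealMatrix D n, Z * W ∈ entryIdealMatrix D n := fun W hW a b => by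
  rw [Matrix.mul_apply]
  exact sum_mem fun c _ => Submodule.smul_mem _ _ (hW c b)

theorem matAt_mem_entryIdealMatrix (D : Matrix (Fin N) (Fin N) A) (hn : 0 < n) :
    matAt N n D 0 ∈ entryIdealMatrix D n := by
  intro a b
  rw [matAt, dif_pos hn, Matrix.of_apply]
  split_ifs
  · exact Submodule.subset_span ⟨_, _, rfl⟩
  · exact zero_mem _

end EntryIdeal

section Scalars

variable {A : Type*} [Ring A] [Algebra ℂ A] {N n : ℕ}

theorem opAt_toA (R : Matrix (Fin N × Fin N) (Fin N × Fin N) ℂ) (i : ℕ) :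
    opAt N n (toA A R) i = toA A (opAt N n R i) := by
  by_cases h : i + 1 < n
  · ext a b
    simp only [opAt, dif_pos h, toA, Matrix.of_apply, Matrix.map_apply]
    split_ifs <;> simp
  · rw [opAt_of_le _ (by omega), opAt_of_le _ (by omega)]
    simp [toA]

theorem toA_mul {ι : Type*} [Fintype ι] (X Y : Matrix ι ι ℂ) :
    toA A (X * Y) = toA A X * toA A Y :=
  Matrix.map_mul

theorem toA_one {ι : Type*} [DecidableEq ι] : toA A (1 : Matrix ι ι ℂ) = 1 := by
  simp [toA]

/-- The operators `R_i` as units, in the matrix algebra over `A`. -/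
def opUnit (A : Type*) [Ring A] [Algebra ℂ A] (N n : ℕ)
    {R Rinv : Matrix (Fin N × Fin N) (Fin N × Fin N) ℂ}
    (h : R * Rinv = 1 ∧ Rinv * R = 1) (i : ℕ) : (Matrix (Fin n → Fin N) (Fin n → Fin N) A)ˣ where
  val := opAt N n (toA A R) i
  inv := opAt N n (toA A Rinv) i
  val_inv := by rw [← opAt_mul, ← toA_mul, h.1, toA_one, opAt_one]
  inv_val := by rw [← opAt_mul, ← toA_mul, h.2, toA_one, opAt_one]

variable {R Rinv : Matrix (Fin N × Fin N) (Fin N × Fin N) ℂ}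

theorem ovCopy_eq_conjCopy (h : R * Rinv = 1 ∧ Rinv * R = 1) (X : Matrix (Fin N) (Fin N) A) :
    ovCopy N n (toA A R) (toA A Rinv) X = conjCopy (opUnit A N n h) (matAt N n X 0) := by
  funext j
  induction j with
  | zero => rfl
  | succ j ih => rw [ovCopy, conjCopy, ih]; rfl

theorem opAt_braid (hb : IsBraid N R) {i : ℕ} (h : i + 2 < n) :
    opAt N n R i * opAt N n R (i + 1) * opAt N n R i =
      opAt N n R (i + 1) * opAt N n R i * opAt N n R (i + 1) := by
  have h3 : i + 3 ≤ n := h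
  have e0 := opAt_add (j := 0) R h3 (by omega)
  have e1 := opAt_add (j := 1) R h3 (by omega)
  rw [add_zero] at e0
  simp only [e0, e1, ← windowEmb_mul (window_injective h3)]
  rw [hb]

theorem isBraidFamily_opUnit (h : R * Rinv = 1 ∧ Rinv * R = 1) (hb : IsBraid N R) :
    IsBraidFamily n (opUnit A N n h) where
  braid i hi := by
    simp only [opUnit, opAt_toA, ← toA_mul, opAt_braid hb hi]
  far i j hij := by
    change opAt N n (toA A R) i * opAt N n (toA A R) j =
      opAt N n (toA A R) j * opAt N n (toA A R) i
    by_cases hj : j + 2 ≤ n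
    · have hi : i + 2 ≤ n := by omega
      have ei := opAt_add (j := 0) R hi (by omega)
      have ej := opAt_add (j := 0) R hj (by omega)
      rw [add_zero] at ei ej
      rw [opAt_toA, opAt_toA, ← toA_mul, ← toA_mul, ei, ej]
      refine congrArg _ (commute_windowEmb (window_injective hi) (window_injective hj) ?_
        fun a b c d => Commute.all _ _)
      intro k l e
      have := congrArg Fin.val e
      simp only [window] at this
      omega
    · simp [opAt_of_le (n := n) _ (show n ≤ j + 1 by omega)]

theorem commute_opAt_matAt (X : Matrix (Fin N) (Fin N) A) (h1 : 1 ≤ n) {i : ℕ} (hi : 1 ≤ i) :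
    Commute (opAt N n (toA A R) i) (matAt N n X 0) := by
  by_cases hn : i + 2 ≤ n
  · have ei := opAt_add (j := 0) (toA A R) hn (by omega)
    have e0 := matAt_add (i := 0) (j := 0) (p := 1) X (show 0 + 1 ≤ n by omega) (by omega)
    rw [add_zero] at ei
    rw [ei, e0]
    refine commute_windowEmb (window_injective _) (window_injective _) ?_ ?_
    · intro k l e
      have := congrArg Fin.val e
      simp only [window] at this
      omega
    · intro a b c d
      rw [opAt_toA]
      exact Algebra.commutes _ _
  · rw [opAt_of_le _ (by omega)]
    exact Commute.one_left _

theorem permRel_embed {M D : Matrix (Fin N) (Fin N) A} (h : PermRel N R Rinv M D) (hn : 2 ≤ n) :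
    matAt N n D 0 * opAt N n (toA A R) 0 * matAt N n M 0 * opAt N n (toA A R) 0 =
      opAt N n (toA A R) 0 * matAt N n M 0 * opAt N n (toA A Rinv) 0 * matAt N n D 0 +
        opAt N n (toA A R) 0 := by
  have hn' : 0 + 2 ≤ n := by omega
  have eo (X : Matrix (Fin N × Fin N) (Fin N × Fin N) A) :=
    opAt_add (i := 0) (j := 0) X hn' (by omega)
  have em (X : Matrix (Fin N) (Fin N) A) := matAt_add (i := 0) (j := 0) X hn' (by omega)
  simp only [add_zero] at eo em
  simp only [eo, em, ← windowEmb_mul (window_injective hn'), ← windowEmb_add]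
  rw [h]

/-- For a Hecke symmetry, `R⁻¹ = R - (q - q⁻¹) I`. -/
theorem IsHecke.inv_eq {q : ℂ} (hq : q ≠ 0) (hH : IsHecke N q R) (h : R * Rinv = 1) :
    Rinv = R - (q - q⁻¹) • (1 : Matrix (Fin N × Fin N) (Fin N × Fin N) ℂ) := by
  have h1 : R * R = 1 + (q - q⁻¹) • R := by
    have e : (q • (1 : Matrix (Fin N × Fin N) (Fin N × Fin N) ℂ) - R) * (q⁻¹ • 1 + R) =
        1 + (q - q⁻¹) • R - R * R := by
      simp only [sub_mul, mul_add, smul_mul_assoc, mul_smul_comm, one_mul, mul_one, smul_sub,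
        smul_smul, inv_mul_cancel₀ hq, one_smul, sub_smul]
      abel
    exact (sub_eq_zero.1 (e.symm.trans hH)).symm
  have h2 := congrArg (· * Rinv) h1
  simp only [mul_assoc, h, mul_one, add_mul, one_mul, smul_mul_assoc] at h2
  rw [eq_sub_iff_add_eq, ← h2]

theorem opAt_inv_mem_adjoin {q : ℂ} (hq : q ≠ 0) (hH : IsHecke N q R) (h : R * Rinv = 1) (i : ℕ) :
    opAt N n (toA A Rinv) i ∈ Algebra.adjoin ℂ (genSet N n n (toA A R)) := by
  by_cases hi : i + 1 < n
  · have : opAt N n (toA A Rinv) i = opAt N n (toA A R) i -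
        algebraMap ℂ (Matrix (Fin n → Fin N) (Fin n → Fin N) A) (q - q⁻¹) := by
      have h1 : opAt N n Rinv i = opAt N n R i - (q - q⁻¹) • 1 := by
        rw [hH.inv_eq hq h, ← opAt_one i]
        ext a b
        simp only [opAt, dif_pos hi, Matrix.of_apply, Matrix.sub_apply, Matrix.smul_apply]
        split_ifs <;> simp
      rw [opAt_toA, h1, opAt_toA]
      ext a b
      simp only [toA, Matrix.map_apply, Matrix.sub_apply, Matrix.smul_apply, map_sub,
        Matrix.algebraMap_matrix_apply, Matrix.one_apply]
      split_ifs <;> simp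
    rw [this]
    exact sub_mem (Algebra.subset_adjoin ⟨i, hi, rfl⟩) (Subalgebra.algebraMap_mem _ _)
  · rw [opAt_of_le _ (by omega)]
    exact one_mem _

theorem tailRing_le_adjoin {q : ℂ} (hq : q ≠ 0) (hH : IsHecke N q R)
    (h : R * Rinv = 1 ∧ Rinv * R = 1) :
    tailRing (opUnit A N n h) 0 ≤ (Algebra.adjoin ℂ (genSet N n n (toA A R))).toSubring := by
  refine Subring.closure_le.2 ?_
  rintro _ ⟨i, -, rfl | rfl⟩
  · change opAt N n (toA A R) i ∈ Algebra.adjoin ℂ (genSet N n n (toA A R))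
    by_cases hi : i + 1 < n
    · exact Algebra.subset_adjoin ⟨i, hi, rfl⟩
    · rw [opAt_of_le _ (by omega)]
      exact one_mem _
  · exact opAt_inv_mem_adjoin hq hH h.1 i

theorem mul_toA_mem_entryIdealMatrix {D : Matrix (Fin N) (Fin N) A}
    {W : Matrix (Fin n → Fin N) (Fin n → Fin N) A} (hW : W ∈ entryIdealMatrix D n)
    (T : Matrix (Fin n → Fin N) (Fin n → Fin N) ℂ) : W * toA A T ∈ entryIdealMatrix D n := by
  intro a b
  rw [Matrix.mul_apply]
  refine sum_mem fun c _ => ?_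
  rw [toA, Matrix.map_apply, ← Algebra.commutes]
  exact Submodule.smul_mem _ _ (hW a c)

theorem mul_mem_entryIdealMatrix_of_mem_tailRing {D : Matrix (Fin N) (Fin N) A}
    (h : R * Rinv = 1 ∧ Rinv * R = 1) :
    ∀ W ∈ entryIdealMatrix D n, ∀ T ∈ tailRing (opUnit A N n h) 0,
      W * T ∈ entryIdealMatrix D n := by
  have hle : tailRing (opUnit A N n h) 0 ≤ (algebraMap ℂ A).mapMatrix.range := by
    refine Subring.closure_le.2 ?_
    rintro _ ⟨i, -, rfl | rfl⟩
    · exact ⟨opAt N n R i, (opAt_toA R i).symm⟩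
    · exact ⟨opAt N n Rinv i, (opAt_toA Rinv i).symm⟩
  intro W hW T hT
  obtain ⟨T', rfl⟩ := hle hT
  exact mul_toA_mem_entryIdealMatrix hW T'

end Scalars

/-- Elements of `sandwich` are finite sums of the generating products. -/
theorem exists_sum_of_mem_sandwich {E : Type*} [Ring E] {r : ℕ → Eˣ} {x y : E} {l : ℕ}
    (hy : y ∈ sandwich r x 0 l) :
    ∃ (J : ℕ) (S T : Fin J → E), (∀ j, S j ∈ tailRing r 0) ∧ (∀ j, T j ∈ tailRing r 0) ∧
      y = ∑ j, S j * conjProd r x 0 l * T j := by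
  induction hy using AddSubgroup.closure_induction with
  | mem y hy =>
    obtain ⟨S, hS, T, hT, rfl⟩ := hy
    exact ⟨1, fun _ => S, fun _ => T, fun _ => hS, fun _ => hT, by simp⟩
  | zero => exact ⟨0, Fin.elim0, Fin.elim0, fun j => j.elim0, fun j => j.elim0, by simp⟩
  | add y z _ _ ihy ihz =>
    obtain ⟨J, S, T, hS, hT, rfl⟩ := ihy
    obtain ⟨J', S', T', hS', hT', rfl⟩ := ihz
    refine ⟨J + J', Fin.append S S', Fin.append T T', ?_, ?_, by simp [Fin.sum_univ_add]⟩
    · exact fun j => Fin.addCases (by simpa using hS) (by simpa using hS') j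
    · exact fun j => Fin.addCases (by simpa using hT) (by simpa using hT') j
  | neg y _ ih =>
    obtain ⟨J, S, T, hS, hT, rfl⟩ := ih
    exact ⟨J, fun j => -S j, T, fun j => neg_mem (hS j), hT, by simp⟩

/-- For `k ≥ m` the action of `D_{⟨1→m⟩}` on `M_{⟨m+1⟩}⋯M_{⟨m+k⟩}`
equals `Σ_j S_j M_{⟨1→(k−m)⟩} T_j` modulo the left ideal generated by the entries of `D`,
with `S_j, T_j` in the subalgebra generated by `R₁, …, R_{m+k−1}`; for `k < m` the
action vanishes modulo that left ideal. -/
theorem stmt7 {A : Type*} [Ring A] [Algebra ℂ A] (N : ℕ) (hN : 1 ≤ N) (q : ℂ)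
    (hq : GenericQ q)
    (R Rinv : Matrix (Fin N × Fin N) (Fin N × Fin N) ℂ)
    (hRinv : R * Rinv = 1 ∧ Rinv * R = 1)
    (hbraid : IsBraid N R) (hHecke : IsHecke N q R)
    (M D : Matrix (Fin N) (Fin N) A)
    (hM : RErel N (toA A R) M)
    (hD : RErel N (toA A Rinv) D)
    (hDM : PermRel N R Rinv M D)
    (m k : ℕ) (hm : 1 ≤ m) (hk : 1 ≤ k) :
    (m ≤ k →
      ∃ (J : ℕ) (S T : Fin J → Matrix (Fin (m + k) → Fin N) (Fin (m + k) → Fin N) A),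
        (∀ j, S j ∈ Algebra.adjoin ℂ (genSet N (m + k) (m + k) (toA A R))) ∧
        (∀ j, T j ∈ Algebra.adjoin ℂ (genSet N (m + k) (m + k) (toA A R))) ∧
        ∀ a b : Fin (m + k) → Fin N,
          (ovProd N (m + k) (toA A R) (toA A Rinv) D m *
              ((List.range' m k).map (ovCopy N (m + k) (toA A R) (toA A Rinv) M)).prod -
            ∑ j, S j * ovProd N (m + k) (toA A R) (toA A Rinv) M (k - m) * T j) a b ∈
              entryIdeal A D) ∧
    (k < m →
      ∀ a b : Fin (m + k) → Fin N,
        (ovProd N (m + k) (toA A R) (toA A Rinv) D m *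
            ((List.range' m k).map (ovCopy N (m + k) (toA A R) (toA A Rinv) M)).prod) a b ∈
          entryIdeal A D) := by
  have hb := isBraidFamily_opUnit (A := A) (n := m + k) hRinv hbraid
  have hD0 := matAt_mem_entryIdealMatrix D (show 0 < m + k by omega)
  obtain ⟨hle, hlt⟩ := hb.prod_conjCopy_mul_mem
    (fun i hi => commute_opAt_matAt M (by omega) hi)
    (fun i hi => commute_opAt_matAt D (by omega) hi)
    (permRel_embed hDM (by omega)) mul_mem_entryIdealMatrix
    (mul_mem_entryIdealMatrix_of_mem_tailRing hRinv) hD0 le_rfl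
    (conjProd_mem_sandwich (opUnit A N (m + k) hRinv) (matAt N (m + k) M 0) m k)
  simp only [ovProd, ovCopy_eq_conjCopy hRinv]
  refine ⟨fun hmk => ?_, fun hkm => hlt hkm⟩
  obtain ⟨u, hu, v, hv, huv⟩ := AddSubgroup.mem_sup.1 (hle hmk)
  obtain ⟨J, S, T, hS, hT, rfl⟩ := exists_sum_of_mem_sandwich hu
  have hH := tailRing_le_adjoin (A := A) (n := m + k) hq.1 hHecke hRinv
  refine ⟨J, S, T, fun j => hH (hS j), fun j => hH (hT j), ?_⟩
  simp only [conjProd, ← List.range_eq_range'] at huv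
  intro a b
  rw [← huv, add_sub_cancel_left]
  exact hv a b
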